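/- Let V = V₃ ⊗ ℝ² where V₃ = S³(ℝ²) is the 4-dimensional irreducible sl(2,ℝ)-module, and let 𝔞 = sl(2,ℝ) × gl(2,ℝ) ⊂ gl(V). Then the kernel of the second Spencer operator ∂² : Hom(Λ²V, 𝔞) → Hom(Λ³V, V) is exactly one-dimensional. -/

import Mathlib

set_option synthInstance.maxHeartbeats 800000
set_option maxHeartbeats 1600000

/-- `V = V₃ ⊗ ℝ²`, modelled as `Fin 4 → Fin 2 → ℝ`. -/
abbrev V7 : Type := Fin 4 → Fin 2 → ℝ

/-- The basis vector `v^i ⊗ e_j` of `V = V₃ ⊗ ℝ²`. -/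
noncomputable def basisVec (i : Fin 4) (j : Fin 2) : V7 :=
  Pi.single i (Pi.single j 1)

/-- The space of bilinear `gl(V)`-valued cochains on `V`. -/
abbrev Cochain2 : Type := V7 →ₗ[ℝ] V7 →ₗ[ℝ] (V7 →ₗ[ℝ] V7)

/-- Evaluation of a bilinear cochain at a pair of vectors, as a linear map. -/
noncomputable def ev2 (u v : V7) : Cochain2 →ₗ[ℝ] (V7 →ₗ[ℝ] V7) :=
  (LinearMap.applyₗ v).comp (LinearMap.applyₗ u)

/-- The kernel of the second Spencer operator `∂² : Hom(Λ²V,𝔞) → Hom(Λ³V,V)`: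
alternating bilinear maps with values in `𝔞 = span{X,H,Y} ⊔ range ι`, satisfying
`−φ(v∧w)u + φ(u∧w)v − φ(u∧v)w = 0`. -/
noncomputable def kerSpencer2 (X H Y : Module.End ℝ V7)
    (ι : Matrix (Fin 2) (Fin 2) ℝ →ₗ[ℝ] Module.End ℝ V7) : Submodule ℝ Cochain2 :=
  (⨅ u : V7, LinearMap.ker (ev2 u u)) ⊓
  (⨅ u : V7, ⨅ v : V7, Submodule.comap (ev2 u v)
    (Submodule.span ℝ ({X, H, Y} : Set (Module.End ℝ V7)) ⊔ LinearMap.range ι)) ⊓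
  (⨅ u : V7, ⨅ v : V7, ⨅ w : V7,
    LinearMap.ker
      (-(LinearMap.applyₗ (R := ℝ) u ∘ₗ ev2 v w) +
        LinearMap.applyₗ (R := ℝ) v ∘ₗ ev2 u w -
        LinearMap.applyₗ (R := ℝ) w ∘ₗ ev2 u v))

theorem basisVec_apply (i r : Fin 4) (j s : Fin 2) :
    basisVec i j r s = if r = i then (if s = j then 1 else 0) else 0 := by
  by_cases h : r = i
  · subst h
    simp [basisVec, Pi.single_apply]
  · simp [basisVec, h]

theorem eq_sum_basisVec (u : V7) : u = ∑ i, ∑ j, u i j • basisVec i j := by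
  ext r s
  fin_cases s <;> simp [Finset.sum_apply, basisVec_apply]

theorem map_eq_sum_basisVec {W : Type*} [AddCommGroup W] [Module ℝ W] (L : V7 →ₗ[ℝ] W) (u : V7) :
    L u = ∑ i, ∑ j, u i j • L (basisVec i j) := by
  conv_lhs => rw [eq_sum_basisVec u]
  simp only [map_sum, map_smul]

theorem hom_ext_basisVec {W : Type*} [AddCommGroup W] [Module ℝ W] {L M : V7 →ₗ[ℝ] W}
    (h : ∀ i j, L (basisVec i j) = M (basisVec i j)) : L = M := by
  refine LinearMap.ext fun u => ?_
  rw [map_eq_sum_basisVec L u, map_eq_sum_basisVec M u]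
  simp only [h]

theorem mem_kerSpencer2 {X H Y : Module.End ℝ V7}
    {ι : Matrix (Fin 2) (Fin 2) ℝ →ₗ[ℝ] Module.End ℝ V7} {φ : Cochain2} :
    φ ∈ kerSpencer2 X H Y ι ↔
      (∀ u, φ u u = 0) ∧
      (∀ u v, ∃ (x h y : ℝ) (A : Matrix (Fin 2) (Fin 2) ℝ),
        φ u v = x • X + h • H + y • Y + ι A) ∧
      ∀ u v w, -φ v w u + φ u w v - φ u v w = 0 := by
  simp only [kerSpencer2, Submodule.mem_inf, Submodule.mem_iInf, LinearMap.mem_ker,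
    Submodule.mem_comap, and_assoc]
  refine and_congr Iff.rfl (and_congr (forall₂_congr fun u v => ?_) Iff.rfl)
  rw [Submodule.mem_sup]
  constructor
  · rintro ⟨p, hp, _, ⟨A, rfl⟩, he⟩
    obtain ⟨x, h, y, rfl⟩ := Submodule.mem_span_triple.1 hp
    exact ⟨x, h, y, A, he.symm⟩
  · rintro ⟨x, h, y, A, he⟩
    exact ⟨_, Submodule.mem_span_triple.2 ⟨x, h, y, rfl⟩, _, ⟨A, rfl⟩, he.symm⟩

/-- The matrix entry from `v^i ⊗ e_j` to `v^r ⊗ e_s` of the element `x X + h H + y Y + ι A`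
of `sl(2) × gl(2)` acting on `V₃ ⊗ ℝ²`. -/
def actionEntry (x h y : ℝ) (A : Matrix (Fin 2) (Fin 2) ℝ)
    (i : Fin 4) (j : Fin 2) (r : Fin 4) (s : Fin 2) : ℝ :=
  (if j = s then
    (if (r : ℕ) = i + 1 then x else 0) + (if r = i then (3 - 2 * (i : ℕ)) * h else 0) +
      (if (r : ℕ) + 1 = i then (i : ℕ) * (4 - (i : ℕ)) * y else 0) else 0) +
    if r = i then A s j else 0

/-- A cocycle, given by its coefficients in `sl(2) × gl(2)`, vanishes as soon as its `X`-coefficient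
on `(v² ⊗ e₀) ∧ (v² ⊗ e₁)` does. -/
theorem cocycle_coeff_eq_zero (x h y : Fin 4 → Fin 2 → Fin 4 → Fin 2 → ℝ)
    (A : Fin 4 → Fin 2 → Fin 4 → Fin 2 → Matrix (Fin 2) (Fin 2) ℝ)
    (E : ∀ i j k l m n r s,
      -actionEntry (x k l m n) (h k l m n) (y k l m n) (A k l m n) i j r s +
      actionEntry (x i j m n) (h i j m n) (y i j m n) (A i j m n) k l r s -
      actionEntry (x i j k l) (h i j k l) (y i j k l) (A i j k l) m n r s = 0)
    (h0 : x 2 0 2 1 = 0) :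
    (∀ i, x i 0 i 1 = 0 ∧ h i 0 i 1 = 0 ∧ y i 0 i 1 = 0 ∧ A i 0 i 1 = 0) ∧
    (∀ i k, i < k → ∀ j l,
      x i j k l = 0 ∧ h i j k l = 0 ∧ y i j k l = 0 ∧ A i j k l = 0) := by
  have e1 := fun j l n => E 0 j 1 l 2 n
  have e2 := fun j l n => E 0 j 1 l 3 n
  have e3 := fun j l n => E 0 j 2 l 3 n
  have e4 := fun j l n => E 1 j 2 l 3 n
  have f1 := fun n => E 0 0 0 1 1 n
  have f2 := fun n => E 0 0 0 1 2 n
  have f3 := fun n => E 0 0 0 1 3 n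
  have f4 := fun n => E 1 0 1 1 2 n
  have f5 := fun n => E 1 0 1 1 3 n
  have f6 := fun n => E 2 0 2 1 3 n
  have f7 := fun n => E 0 n 1 0 1 1
  have f8 := fun n => E 0 n 2 0 2 1
  have f9 := fun n => E 0 n 3 0 3 1
  have f10 := fun n => E 1 n 2 0 2 1
  have f11 := fun n => E 1 n 3 0 3 1
  have f12 := fun n => E 2 n 3 0 3 1
  clear E
  simp only [actionEntry, Fin.forall_fin_succ,
    IsEmpty.forall_iff] at e1 e2 e3 e4 f1 f2 f3 f4 f5 f6 f7 f8 f9 f10 f11 f12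
  norm_num [Fin.ext_iff] at e1 e2 e3 e4 f1 f2 f3 f4 f5 f6 f7 f8 f9 f10 f11 f12
  simp [← Matrix.ext_iff, Fin.forall_fin_succ]
  grind (splits := 400)

/-- The value on `u ∧ v` of the bracket of `G₂`, as a cochain `Λ²V → sl(2) × gl(2)`. -/
def bracketValue (X H Y : Module.End ℝ V7)
    (ι : Matrix (Fin 2) (Fin 2) ℝ →ₗ[ℝ] Module.End ℝ V7) (u v : V7) : Module.End ℝ V7 :=
  let p (i : Fin 4) (j : Fin 2) (k : Fin 4) (l : Fin 2) : ℝ := u i j * v k l - u k l * v i j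
  (8 * p 2 0 2 1 - 6 * p 1 0 3 1 + 6 * p 1 1 3 0) • X +
  (p 1 0 2 1 - p 1 1 2 0 - 3 * p 0 0 3 1 + 3 * p 0 1 3 0) • H +
  (2 * p 0 0 2 1 - 2 * p 0 1 2 0 - 2 * p 1 0 1 1) • Y +
  ((3 * (p 1 0 2 1 + p 1 1 2 0 - p 0 0 3 1 - p 0 1 3 0)) •
      (ι (Matrix.single 0 0 1) - ι (Matrix.single 1 1 1)) +
    (6 * (p 0 0 3 0 - p 1 0 2 0)) • ι (Matrix.single 0 1 1) +
    (6 * (p 1 1 2 1 - p 0 1 3 1)) • ι (Matrix.single 1 0 1))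

/-- The bracket of `G₂` as a bilinear cochain. -/
noncomputable def bracketCochain (X H Y : Module.End ℝ V7)
    (ι : Matrix (Fin 2) (Fin 2) ℝ →ₗ[ℝ] Module.End ℝ V7) : Cochain2 :=
  LinearMap.mk₂ ℝ (bracketValue X H Y ι)
    (fun u u' v => by simp only [bracketValue, Pi.add_apply]; module)
    (fun c u v => by simp only [bracketValue, Pi.smul_apply, smul_eq_mul]; module)
    (fun u v v' => by simp only [bracketValue, Pi.add_apply]; module)
    (fun c u v => by simp only [bracketValue, Pi.smul_apply, smul_eq_mul]; module)

theorem bracketCochain_apply (X H Y : Module.End ℝ V7)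
    (ι : Matrix (Fin 2) (Fin 2) ℝ →ₗ[ℝ] Module.End ℝ V7) (u v : V7) :
    bracketCochain X H Y ι u v = bracketValue X H Y ι u v :=
  rfl

/-- Coordinate formulas for the operators of `sl(2) × gl(2)` on `V₃ ⊗ ℝ²`. -/
structure IsStandardAction (X H Y : Module.End ℝ V7)
    (ι : Matrix (Fin 2) (Fin 2) ℝ →ₗ[ℝ] Module.End ℝ V7) : Prop where
  X_apply : ∀ u, X u = ![0, u 0, u 1, u 2]
  H_apply : ∀ u, H u = ![(3 : ℝ) • u 0, u 1, -u 2, (-3 : ℝ) • u 3]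
  Y_apply : ∀ u, Y u = ![(3 : ℝ) • u 1, (4 : ℝ) • u 2, (3 : ℝ) • u 3, 0]
  ι_apply : ∀ A u, ι A u = fun r s => A s 0 * u r 0 + A s 1 * u r 1

theorem action_basisVec_apply {X H Y : Module.End ℝ V7}
    {ι : Matrix (Fin 2) (Fin 2) ℝ →ₗ[ℝ] Module.End ℝ V7} (hs : IsStandardAction X H Y ι)
    (x h y : ℝ) (A : Matrix (Fin 2) (Fin 2) ℝ)
    (i : Fin 4) (j : Fin 2) (r : Fin 4) (s : Fin 2) :
    (x • X + h • H + y • Y + ι A) (basisVec i j) r s = actionEntry x h y A i j r s := by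
  simp only [LinearMap.add_apply, LinearMap.smul_apply, hs.X_apply, hs.H_apply, hs.Y_apply,
    hs.ι_apply, Pi.add_apply, Pi.smul_apply, basisVec_apply, actionEntry, smul_eq_mul]
  fin_cases i <;> fin_cases j <;> fin_cases r <;> fin_cases s <;>
    norm_num [basisVec_apply, Fin.ext_iff] <;> ring

theorem eq_zero_of_mem_kerSpencer2 {X H Y : Module.End ℝ V7}
    {ι : Matrix (Fin 2) (Fin 2) ℝ →ₗ[ℝ] Module.End ℝ V7} (hs : IsStandardAction X H Y ι)
    {ψ : Cochain2} (hψ : ψ ∈ kerSpencer2 X H Y ι)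
    (h0 : ψ (basisVec 2 0) (basisVec 2 1) (basisVec 0 0) 1 0 = 0) : ψ = 0 := by
  obtain ⟨halt, hval, hS⟩ := mem_kerSpencer2.1 hψ
  choose x h y A hval using hval
  have hanti : ∀ u v, ψ u v = -ψ v u := by
    intro u v
    have := halt (u + v)
    simp only [map_add, LinearMap.add_apply, halt, zero_add, add_zero] at this
    rw [add_comm] at this
    exact eq_neg_of_add_eq_zero_left this
  obtain ⟨hd, ho⟩ := cocycle_coeff_eq_zero
    (fun i j k l => x (basisVec i j) (basisVec k l)) (fun i j k l => h (basisVec i j) (basisVec k l))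
    (fun i j k l => y (basisVec i j) (basisVec k l)) (fun i j k l => A (basisVec i j) (basisVec k l))
    (fun i j k l m n r s => by
      have := congrFun (congrFun (hS (basisVec i j) (basisVec k l) (basisVec m n)) r) s
      simpa only [Pi.sub_apply, Pi.add_apply, Pi.neg_apply, Pi.zero_apply, hval,
        action_basisVec_apply hs] using this)
    (by simpa [hval, action_basisVec_apply hs, actionEntry] using h0)
  have hlt : ∀ i k, i < k → ∀ j l, ψ (basisVec i j) (basisVec k l) = 0 := by
    intro i k hik j l
    obtain ⟨h1, h2, h3, h4⟩ := ho i k hik j l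
    simp [hval, h1, h2, h3, h4]
  have hdiag : ∀ i, ψ (basisVec i 0) (basisVec i 1) = 0 := by
    intro i
    obtain ⟨h1, h2, h3, h4⟩ := hd i
    simp [hval, h1, h2, h3, h4]
  refine hom_ext_basisVec fun i j => hom_ext_basisVec fun k l => ?_
  rcases lt_trichotomy i k with hik | rfl | hik
  · exact hlt i k hik j l
  · fin_cases j <;> fin_cases l
    · exact halt _
    · exact hdiag i
    · exact (hanti _ _).trans (by simpa using hdiag i)
    · exact halt _
  · rw [hanti, hlt k i hik l j]
    simp

theorem bracketCochain_mem_kerSpencer2 {X H Y : Module.End ℝ V7}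
    {ι : Matrix (Fin 2) (Fin 2) ℝ →ₗ[ℝ] Module.End ℝ V7} (hs : IsStandardAction X H Y ι) :
    bracketCochain X H Y ι ∈ kerSpencer2 X H Y ι := by
  refine mem_kerSpencer2.2 ⟨fun u => ?_, fun u v => ?_, fun u v w => ?_⟩
  · simp only [bracketCochain_apply, bracketValue]
    module
  · simp only [bracketCochain_apply, bracketValue, ← map_smul, ← map_add, ← map_sub]
    exact ⟨_, _, _, _, rfl⟩
  · ext r s
    simp only [bracketCochain_apply, bracketValue, LinearMap.add_apply, LinearMap.sub_apply,
      LinearMap.smul_apply, hs.X_apply, hs.H_apply, hs.Y_apply, hs.ι_apply, Pi.add_apply, Pi.sub_apply,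
      Pi.neg_apply, Pi.smul_apply, Pi.zero_apply]
    fin_cases r <;> fin_cases s <;> simp <;> ring

theorem bracketCochain_coeff {X H Y : Module.End ℝ V7}
    {ι : Matrix (Fin 2) (Fin 2) ℝ →ₗ[ℝ] Module.End ℝ V7} (hs : IsStandardAction X H Y ι) :
    bracketCochain X H Y ι (basisVec 2 0) (basisVec 2 1) (basisVec 0 0) 1 0 = 8 := by
  simp only [bracketCochain_apply, bracketValue, LinearMap.add_apply, LinearMap.sub_apply,
    LinearMap.smul_apply, hs.X_apply, hs.H_apply, hs.Y_apply, hs.ι_apply]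
  simp [basisVec_apply]

/-- Let `V = V₃ ⊗ ℝ²` where `V₃ = S³(ℝ²)` is the 4-dimensional
irreducible `sl(2,ℝ)`-module, and `𝔞 = sl(2,ℝ) × gl(2,ℝ) ⊂ gl(V)` (span of the
`sl(2)`-generators `X, H, Y` together with the range of `ι : gl(2,ℝ) → gl(V)`).
Then the kernel of the second Spencer operator `∂²` is exactly one-dimensional,
i.e. it is the span of a single nonzero cochain. -/
theorem ker_second_spencer_one_dimensional
    (X H Y : Module.End ℝ V7)
    (ι : Matrix (Fin 2) (Fin 2) ℝ →ₗ[ℝ] Module.End ℝ V7)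
    (hX : ∀ (i : Fin 4) (j : Fin 2), X (basisVec i j) =
      if h : (i : ℕ) < 3 then basisVec (⟨(i : ℕ) + 1, by omega⟩ : Fin 4) j else 0)
    (hH : ∀ (i : Fin 4) (j : Fin 2), H (basisVec i j) =
      ((3 : ℝ) - 2 * (i : ℕ)) • basisVec i j)
    (hY : ∀ (i : Fin 4) (j : Fin 2), Y (basisVec i j) =
      if h : 0 < (i : ℕ) then
        (((i : ℕ) : ℝ) * ((3 : ℝ) + 1 - (i : ℕ))) •
          basisVec (⟨(i : ℕ) - 1, by omega⟩ : Fin 4) j else 0)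
    (hι : ∀ (A : Matrix (Fin 2) (Fin 2) ℝ) (i : Fin 4) (j : Fin 2),
      ι A (basisVec i j) = ∑ l : Fin 2, A l j • basisVec i l) :
    ∃ φ₀ : Cochain2, φ₀ ≠ 0 ∧ kerSpencer2 X H Y ι = Submodule.span ℝ {φ₀} := by
  have hs : IsStandardAction X H Y ι := by
    refine ⟨fun u => ?_, fun u => ?_, fun u => ?_, fun A u => ?_⟩
    · rw [map_eq_sum_basisVec X u]
      ext r s
      simp only [hX, Fin.sum_univ_four, Fin.sum_univ_two, Pi.add_apply, Pi.smul_apply]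
      fin_cases r <;> fin_cases s <;> simp [basisVec_apply, Fin.ext_iff]
    · rw [map_eq_sum_basisVec H u]
      ext r s
      simp only [hH, Fin.sum_univ_four, Fin.sum_univ_two, Pi.add_apply, Pi.smul_apply]
      fin_cases r <;> fin_cases s <;> norm_num [basisVec_apply, Fin.ext_iff] <;> ring
    · rw [map_eq_sum_basisVec Y u]
      ext r s
      simp only [hY, Fin.sum_univ_four, Fin.sum_univ_two, Pi.add_apply, Pi.smul_apply]
      fin_cases r <;> fin_cases s <;> norm_num [basisVec_apply, Fin.ext_iff] <;> ring
    · rw [map_eq_sum_basisVec (ι A) u]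
      ext r s
      simp only [hι, Fin.sum_univ_four, Fin.sum_univ_two, Pi.add_apply, Pi.smul_apply]
      fin_cases r <;> fin_cases s <;> simp [basisVec_apply, Fin.ext_iff] <;> ring
  have hmem := bracketCochain_mem_kerSpencer2 hs
  have hcoeff := bracketCochain_coeff hs
  refine ⟨bracketCochain X H Y ι, fun h => by simp [h] at hcoeff, le_antisymm (fun φ hφ => ?_)
    ((Submodule.span_singleton_le_iff_mem _ _).2 hmem)⟩
  set c := φ (basisVec 2 0) (basisVec 2 1) (basisVec 0 0) 1 0 / 8 with hc
  have h := eq_zero_of_mem_kerSpencer2 hs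
    (Submodule.add_mem _ hφ (Submodule.smul_mem _ (-c) hmem)) (by
      simp only [LinearMap.add_apply, LinearMap.smul_apply, Pi.add_apply, Pi.smul_apply, hcoeff,
        smul_eq_mul, hc]
      ring)
  refine Submodule.mem_span_singleton.2 ⟨c, LinearMap.ext₂ fun u v => ?_⟩
  have huv := LinearMap.congr_fun₂ h u v
  simp only [LinearMap.add_apply, LinearMap.smul_apply, LinearMap.zero_apply, neg_smul] at huv
  exact (add_neg_eq_zero.1 huv).symm
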